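/- Let n ≥ 2 and d ≥ 1 be natural numbers, let μ ∈ ℝ, and set K = (n^{d+1} − 1)/(n − 1). The following are equivalent: (i) for every k ∈ ℕ and all hermitian complex k×k matrices X_1, …, X_n, H_{2d}(X_1, …, X_n) ⪰ μ(X_1^{2d} + ⋯ + X_n^{2d}); (ii) for all real symmetric K×K matrices X_1, …, X_n, H_{2d}(X_1, …, X_n) ⪰ μ(X_1^{2d} + ⋯ + X_n^{2d}); (iii) the matrix G_{n,d} − μ·M_{n,d} is positive semidefinite. -/

import Mathlib

open Matrix BigOperators ComplexOrder

/-- Product of ring elements along a word `w : Fin d → Fin n`: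
`X_{w 0} * X_{w 1} * ⋯ * X_{w (d-1)}`. -/
noncomputable def wordProd {R : Type*} [Monoid R] {n d : ℕ} (X : Fin n → R)
    (w : Fin d → Fin n) : R :=
  (List.ofFn fun i => X (w i)).prod

/-- Number of occurrences of the letter `j` in the word `w`. -/
def letterCount {n d : ℕ} (w : Fin d → Fin n) (j : Fin n) : ℕ :=
  (Finset.univ.filter fun i => w i = j).card

/-- Coefficient of the word `w` in the NCHS polynomial of degree `d`:
`(∏_j k_j(w)!) / d!`. -/
noncomputable def nchsCoeff {n : ℕ} (d : ℕ) (w : Fin d → Fin n) : ℝ :=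
  ((∏ j : Fin n, (letterCount w j).factorial : ℕ) : ℝ) / (d.factorial : ℝ)

/-- The noncommutative complete homogeneous symmetric polynomial of degree `d`
evaluated at `X`. -/
noncomputable def nchs {R : Type*} [Ring R] [Module ℝ R] {n : ℕ} (d : ℕ)
    (X : Fin n → R) : R :=
  ∑ w : Fin d → Fin n, nchsCoeff d w • wordProd X w

/-- The matrix `G_{n,d}`, indexed by words of degree `d` in `n` letters. -/
noncomputable def Gmat (n d : ℕ) : Matrix (Fin d → Fin n) (Fin d → Fin n) ℝ :=
  fun u v =>
    ((∏ j : Fin n, (letterCount u j + letterCount v j).factorial : ℕ) : ℝ) /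
      ((2 * d).factorial : ℝ)

/-- The diagonal 0–1 matrix `M_{n,d}` whose diagonal entry at a word `w` is 1
iff `w` is a constant word. -/
noncomputable def Mmat (n d : ℕ) : Matrix (Fin d → Fin n) (Fin d → Fin n) ℝ :=
  fun u v => if u = v ∧ ∃ j : Fin n, u = fun _ => j then 1 else 0

lemma wordProd_append {R : Type*} [Monoid R] {n a b : ℕ} (X : Fin n → R)
    (u : Fin a → Fin n) (v : Fin b → Fin n) :
    wordProd X (Fin.append u v) = wordProd X u * wordProd X v := by
  have h : (fun i => X (Fin.append u v i)) =
      Fin.append (fun i => X (u i)) (fun i => X (v i)) := by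
    ext i
    refine Fin.addCases (fun i => ?_) (fun i => ?_) i <;> simp
  simp only [wordProd]
  rw [h, List.ofFn_fin_append, List.prod_append]

lemma wordProd_eq_prod_map {R : Type*} [Monoid R] {n d : ℕ} (X : Fin n → R)
    (u : Fin d → Fin n) : wordProd X u = ((List.ofFn u).map X).prod := by
  rw [wordProd, List.map_ofFn]
  rfl

lemma wordProd_const {R : Type*} [Monoid R] {n d : ℕ} (X : Fin n → R) (j : Fin n) :
    wordProd X (fun _ : Fin d => j) = X j ^ d := by
  simp [wordProd]

lemma map_wordProd {R S : Type*} [Monoid R] [Monoid S] (φ : R →* S) {n d : ℕ} (X : Fin n → R)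
    (u : Fin d → Fin n) : φ (wordProd X u) = wordProd (fun j => φ (X j)) u := by
  simp only [wordProd, map_list_prod, List.map_ofFn]
  rfl

lemma star_wordProd {R : Type*} [Monoid R] [StarMul R] {n d : ℕ} (X : Fin n → R)
    (hX : ∀ j, star (X j) = X j) (u : Fin d → Fin n) :
    star (wordProd X u) = wordProd X (u ∘ Fin.rev) := by
  have h : ∀ l : List (Fin n), star (l.map X).prod = (l.reverse.map X).prod := by
    intro l
    induction l with
    | nil => simp
    | cons a l ih => simp [ih, hX]
  rw [wordProd_eq_prod_map, wordProd_eq_prod_map, h]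
  congr 2
  apply List.ext_getElem <;> simp [Fin.rev, Nat.sub_sub, add_comm]

lemma letterCount_append {n a b : ℕ} (u : Fin a → Fin n) (v : Fin b → Fin n) (j : Fin n) :
    letterCount (Fin.append u v) j = letterCount u j + letterCount v j := by
  simp only [letterCount, Finset.card_filter, Fin.sum_univ_add, Fin.append_left,
    Fin.append_right]

lemma letterCount_comp_rev {n d : ℕ} (u : Fin d → Fin n) (j : Fin n) :
    letterCount (u ∘ Fin.rev) j = letterCount u j := by
  simp only [letterCount, Finset.card_filter]
  exact Equiv.sum_comp Fin.revPerm fun i => if u i = j then 1 else 0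

lemma nchs_eq_sum_Gmat {R : Type*} [Ring R] [Module ℝ R] [StarMul R] {n d : ℕ}
    (X : Fin n → R) (hX : ∀ j, star (X j) = X j) :
    nchs (2 * d) X = ∑ u, ∑ v, Gmat n d u v • (star (wordProd X u) * wordProd X v) := by
  have key : ∀ m (hm : m = d + d), nchs m X = ∑ u : Fin d → Fin n, ∑ v : Fin d → Fin n,
      (((∏ j : Fin n, (letterCount u j + letterCount v j).factorial : ℕ) : ℝ) /
      (m.factorial : ℝ)) • (star (wordProd X u) * wordProd X v) := by
    rintro m rfl
    rw [nchs, ← Equiv.sum_comp (Fin.appendEquiv d d), Fintype.sum_prod_type,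
      ← Equiv.sum_comp (Equiv.arrowCongr (Fin.revPerm (n := d)) (Equiv.refl (Fin n)))]
    refine Finset.sum_congr rfl fun u _ => Finset.sum_congr rfl fun v _ => ?_
    have hu : (Equiv.arrowCongr (Fin.revPerm (n := d)) (Equiv.refl (Fin n))) u = u ∘ Fin.rev := by
      ext i; simp
    rw [hu, star_wordProd X hX]
    simp [Fin.appendEquiv, nchsCoeff, wordProd_append, letterCount_append, letterCount_comp_rev]
  exact key _ (two_mul d)

lemma sum_pow_eq_sum_Mmat {R : Type*} [Ring R] [Module ℝ R] [StarMul R] {n d : ℕ} (hd : 1 ≤ d)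
    (X : Fin n → R) (hX : ∀ j, star (X j) = X j) :
    ∑ j, X j ^ (2 * d) = ∑ u, ∑ v, Mmat n d u v • (star (wordProd X u) * wordProd X v) := by
  classical
  have hinj : Function.Injective fun (j : Fin n) (_ : Fin d) => j :=
    fun i j h => congrFun h ⟨0, hd⟩
  have h1 : ∀ u : Fin d → Fin n, ∑ v, Mmat n d u v • (star (wordProd X u) * wordProd X v) =
      if u ∈ Finset.univ.image (fun (j : Fin n) (_ : Fin d) => j) then
        star (wordProd X u) * wordProd X u else 0 := by
    intro u
    rw [Finset.sum_eq_single u]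
    · simp [Mmat, eq_comm]
    · intro v _ hv
      simp [Mmat, hv.symm]
    · simp
  simp_rw [h1]
  rw [← Finset.sum_filter, Finset.filter_mem_eq_inter, Finset.univ_inter,
    Finset.sum_image hinj.injOn]
  refine Finset.sum_congr rfl fun j _ => ?_
  rw [wordProd_const, star_pow, hX, two_mul, pow_add]

lemma nchs_sub_eq_sum {R : Type*} [Ring R] [Module ℝ R] [StarMul R] {n d : ℕ} (hd : 1 ≤ d)
    (μ : ℝ) (X : Fin n → R) (hX : ∀ j, star (X j) = X j) :
    nchs (2 * d) X - μ • ∑ j, X j ^ (2 * d) =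
      ∑ u, ∑ v, (Gmat n d - μ • Mmat n d) u v • (star (wordProd X u) * wordProd X v) := by
  rw [nchs_eq_sum_Gmat X hX, sum_pow_eq_sum_Mmat hd X hX]
  simp [sub_smul, mul_smul, Finset.smul_sum, Finset.sum_sub_distrib]

/-- A real positive semidefinite matrix `A` makes `∑ A u v • (Y u)ᴴ * Y v` positive
semidefinite. -/
lemma posSemidef_sum_smul_conjTranspose_mul {𝕜 ι κ : Type*} [RCLike 𝕜] [Fintype ι] [Fintype κ]
    {A : Matrix ι ι ℝ} (hA : A.PosSemidef) (Y : ι → Matrix κ κ 𝕜) :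
    (∑ u, ∑ v, A u v • ((Y u)ᴴ * Y v)).PosSemidef := by
  classical
  obtain ⟨B, rfl⟩ : ∃ B : Matrix ι ι ℝ, A = Bᴴ * B := by
    open scoped MatrixOrder in
    exact CStarAlgebra.nonneg_iff_eq_star_mul_self.mp hA.nonneg
  have h : ∑ u, ∑ v, (Bᴴ * B) u v • ((Y u)ᴴ * Y v) =
      ∑ w, (∑ u, B w u • Y u)ᴴ * (∑ u, B w u • Y u) := calc
    _ = ∑ u, ∑ w, ∑ v, (B w u * B w v) • ((Y u)ᴴ * Y v) := by
      refine Finset.sum_congr rfl fun u _ => ?_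
      rw [Finset.sum_comm]
      simp only [Matrix.mul_apply, Matrix.conjTranspose_apply, Finset.sum_smul, star_trivial]
    _ = _ := by
      rw [Finset.sum_comm]
      simp only [Matrix.conjTranspose_sum, Matrix.conjTranspose_smul, Finset.sum_mul_sum,
        star_trivial, smul_mul_smul_comm]
  rw [h]
  exact Matrix.posSemidef_sum _ fun w _ => Matrix.posSemidef_conjTranspose_mul_self _

/-- The truncated operator creating the letter `j`, plus its adjoint, on a space with a basis
labelled by words; it only connects words of length less than `d`. -/
def fockMat {n : ℕ} {κ : Type*} (d : ℕ) (w : κ → List (Fin n)) (j : Fin n) : Matrix κ κ ℝ :=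
  .of fun a b => if (w a = j :: w b ∧ (w a).length < d) ∨ (w b = j :: w a ∧ (w b).length < d)
    then 1 else 0

/-- The vacuum vector. -/
def vacuum {n : ℕ} {κ : Type*} (w : κ → List (Fin n)) : κ → ℝ := fun b => if w b = [] then 1 else 0

/-- The functional on words of length `d - 1` given by `l ↦ F (j :: l)`. -/
def topVec {n : ℕ} {κ : Type*} (d : ℕ) (w : κ → List (Fin n)) (F : List (Fin n) → ℝ)
    (j : Fin n) : κ → ℝ :=
  fun b => if (w b).length + 1 = d then F (j :: w b) else 0

/-- The perturbation of `fockMat` which sends words `l` of length `d - 1` to `t * F (j :: l)`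
times the basis vector at `s`. -/
def pertMat {n : ℕ} {κ : Type*} [DecidableEq κ] (d : ℕ) (w : κ → List (Fin n))
    (F : List (Fin n) → ℝ) (s : κ) (t : ℝ) (j : Fin n) : Matrix κ κ ℝ :=
  fockMat d w j + t • (vecMulVec (Pi.single s 1) (topVec d w F j) +
    vecMulVec (topVec d w F j) (Pi.single s 1))

lemma fockMat_isSymm {n d : ℕ} {κ : Type*} (w : κ → List (Fin n))
    (j : Fin n) : (fockMat d w j).IsSymm := by
  ext a b
  simp only [fockMat, Matrix.transpose_apply, Matrix.of_apply]
  congr 1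
  exact propext or_comm

lemma pertMat_isSymm {n d : ℕ} {κ : Type*} [DecidableEq κ] (w : κ → List (Fin n))
    (F : List (Fin n) → ℝ) (s : κ) (t : ℝ) (j : Fin n) : (pertMat d w F s t j).IsSymm := by
  rw [Matrix.IsSymm, pertMat, Matrix.transpose_add, Matrix.transpose_smul, Matrix.transpose_add,
    Matrix.transpose_vecMulVec, Matrix.transpose_vecMulVec, fockMat_isSymm, add_comm (vecMulVec _ _)]

lemma fockMat_mulVec_apply_of_length_eq {n d : ℕ} {κ : Type*} [Fintype κ]
    (w : κ → List (Fin n)) (j : Fin n) (φ : κ → ℝ) {s : κ} (hs : (w s).length = d) :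
    (fockMat d w j *ᵥ φ) s = 0 := by
  refine Finset.sum_eq_zero fun b _ => ?_
  have : ¬ ((w s = j :: w b ∧ (w s).length < d) ∨ (w b = j :: w s ∧ (w b).length < d)) := by
    rintro (⟨_, h⟩ | ⟨h1, h2⟩)
    · omega
    · rw [h1, List.length_cons] at h2
      omega
  simp [fockMat, this]

lemma fockMat_prod_mulVec_vacuum_apply {n d : ℕ} {κ : Type*} [Fintype κ] [DecidableEq κ]
    {w : κ → List (Fin n)} (hw : w.Injective)
    (hsurj : ∀ l : List (Fin n), l.length ≤ d → ∃ b, w b = l) (l : List (Fin n))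
    (hl : l.length < d) (a : κ) (ha : l.length ≤ (w a).length) :
    ((l.map (fockMat d w)).prod *ᵥ vacuum w) a = if w a = l then 1 else 0 := by
  induction l generalizing a with
  | nil => simp [vacuum]
  | cons j l ih =>
    rw [List.length_cons] at hl ha
    obtain ⟨b, hb⟩ := hsurj l (by omega)
    rw [List.map_cons, List.prod_cons, ← Matrix.mulVec_mulVec]
    set φ := (l.map (fockMat d w)).prod *ᵥ vacuum w
    have ih' := ih (by omega)
    rw [Matrix.mulVec, dotProduct, Finset.sum_eq_single b]
    · rw [ih' b (by rw [hb]), if_pos hb, mul_one, fockMat, Matrix.of_apply, hb]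
      congr 1
      apply propext
      constructor
      · rintro (⟨h, _⟩ | ⟨h, _⟩)
        · exact h
        · have := congrArg List.length h
          simp at this
          omega
      · intro h
        left
        refine ⟨h, ?_⟩
        rw [h]
        simpa using hl
    · intro c _ hc
      by_cases hlen : l.length ≤ (w c).length
      · rw [ih' c hlen, if_neg (fun h => hc (hw (h.trans hb.symm))), mul_zero]
      · rw [fockMat, Matrix.of_apply, if_neg, zero_mul]
        rintro (⟨h, _⟩ | ⟨h, _⟩)
        all_goals
          have := congrArg List.length h
          simp at this
          omega
    · simp

lemma pertMat_mulVec_fockMat {n d : ℕ} {κ : Type*} [Fintype κ] [DecidableEq κ]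
    {w : κ → List (Fin n)} (hw : w.Injective)
    (hsurj : ∀ l : List (Fin n), l.length ≤ d → ∃ b, w b = l) (F : List (Fin n) → ℝ) {s : κ}
    (hs : (w s).length = d) (t : ℝ) (j : Fin n) (l : List (Fin n)) (hl : l.length < d) :
    pertMat d w F s t j *ᵥ ((l.map (fockMat d w)).prod *ᵥ vacuum w) =
      ((j :: l).map (fockMat d w)).prod *ᵥ vacuum w +
        (t * if l.length + 1 = d then F (j :: l) else 0) • Pi.single s 1 := by
  have hφ := fockMat_prod_mulVec_vacuum_apply hw hsurj l hl
  rw [List.map_cons, List.prod_cons, ← Matrix.mulVec_mulVec]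
  set φ := (l.map (fockMat d w)).prod *ᵥ vacuum w
  have hφs : φ s = 0 := by
    rw [hφ s (by omega), if_neg]
    rintro h
    rw [h] at hs
    omega
  have htop : topVec d w F j ⬝ᵥ φ = if l.length + 1 = d then F (j :: l) else 0 := by
    obtain ⟨b, hb⟩ := hsurj l hl.le
    rw [dotProduct, Finset.sum_eq_single b]
    · rw [hφ b (by rw [hb]), if_pos hb, mul_one, topVec, hb]
    · intro c _ hc
      by_cases hlen : (w c).length + 1 = d
      · rw [hφ c (by omega), if_neg (fun h => hc (hw (h.trans hb.symm))), mul_zero]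
      · rw [topVec, if_neg hlen, zero_mul]
    · simp
  rw [pertMat, Matrix.add_mulVec, Matrix.smul_mulVec, Matrix.add_mulVec, Matrix.vecMulVec_mulVec,
    Matrix.vecMulVec_mulVec, htop, single_dotProduct, hφs]
  simp [mul_smul]

lemma pertMat_prod_mulVec_vacuum_of_lt {n d : ℕ} {κ : Type*} [Fintype κ] [DecidableEq κ]
    {w : κ → List (Fin n)} (hw : w.Injective)
    (hsurj : ∀ l : List (Fin n), l.length ≤ d → ∃ b, w b = l) (F : List (Fin n) → ℝ) {s : κ}
    (hs : (w s).length = d) (t : ℝ) (l : List (Fin n)) (hl : l.length < d) :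
    (l.map (pertMat d w F s t)).prod *ᵥ vacuum w =
      (l.map (fockMat d w)).prod *ᵥ vacuum w := by
  induction l with
  | nil => simp
  | cons j l ih =>
    rw [List.length_cons] at hl
    rw [List.map_cons, List.prod_cons, ← Matrix.mulVec_mulVec, ih (by omega),
      pertMat_mulVec_fockMat hw hsurj F hs t j l (by omega), if_neg (by omega)]
    simp

lemma pertMat_prod_mulVec_vacuum_of_eq {n d : ℕ} {κ : Type*} [Fintype κ] [DecidableEq κ]
    (hd : 1 ≤ d) {w : κ → List (Fin n)}
    (hw : w.Injective) (hsurj : ∀ l : List (Fin n), l.length ≤ d → ∃ b, w b = l)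
    (F : List (Fin n) → ℝ) {s : κ} (hs : (w s).length = d) (t : ℝ) (l : List (Fin n))
    (hl : l.length = d) :
    (l.map (pertMat d w F s t)).prod *ᵥ vacuum w =
      (l.map (fockMat d w)).prod *ᵥ vacuum w + (t * F l) • Pi.single s 1 := by
  cases l with
  | nil => simp at hl; omega
  | cons j l =>
    rw [List.length_cons] at hl
    rw [List.map_cons, List.prod_cons, ← Matrix.mulVec_mulVec,
      pertMat_prod_mulVec_vacuum_of_lt hw hsurj F hs t l (by omega),
      pertMat_mulVec_fockMat hw hsurj F hs t j l (by omega), if_pos hl]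

lemma fockMat_prod_mulVec_apply_of_length_eq {n d : ℕ} {κ : Type*} [Fintype κ] [DecidableEq κ]
    (hd : 1 ≤ d) (w : κ → List (Fin n)) {s : κ} (hs : (w s).length = d)
    (l : List (Fin n)) (hl : l.length = d) (φ : κ → ℝ) :
    ((l.map (fockMat d w)).prod *ᵥ φ) s = 0 := by
  cases l with
  | nil => simp at hl; omega
  | cons j l =>
    rw [List.map_cons, List.prod_cons, ← Matrix.mulVec_mulVec,
      fockMat_mulVec_apply_of_length_eq w j _ hs]

/-- If `∑ A u v • (X_u)ᵀ * X_v` is positive semidefinite for all symmetric tuples of matrices whose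
rows are labelled by the words of length at most `d`, then the quadratic form of `A` is
nonnegative. -/
lemma nonneg_of_forall_posSemidef {n d : ℕ} {κ : Type*} [Fintype κ] [DecidableEq κ]
    (hn : 1 ≤ n) (hd : 1 ≤ d)
    {w : κ → List (Fin n)} (hw : w.Injective)
    (hsurj : ∀ l : List (Fin n), l.length ≤ d → ∃ b, w b = l)
    (A : Matrix (Fin d → Fin n) (Fin d → Fin n) ℝ)
    (hA : ∀ X : Fin n → Matrix κ κ ℝ, (∀ j, (X j).IsSymm) →
      (∑ u, ∑ v, A u v • ((wordProd X u)ᴴ * wordProd X v)).PosSemidef)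
    (f : (Fin d → Fin n) → ℝ) : 0 ≤ f ⬝ᵥ (A *ᵥ f) := by
  obtain ⟨s, hs'⟩ := hsurj (List.replicate d ⟨0, hn⟩) (by simp)
  have hs : (w s).length = d := by simp [hs']
  set F : List (Fin n) → ℝ := Function.extend List.ofFn f 0
  have hF : ∀ u, F (List.ofFn u) = f u := fun u => List.ofFn_injective.extend_apply f 0 u
  set y : (Fin d → Fin n) → κ → ℝ := fun u => wordProd (fockMat d w) u *ᵥ vacuum w with hy
  have hys : ∀ u, y u s = 0 := fun u => by
    simp only [hy, wordProd_eq_prod_map]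
    exact fockMat_prod_mulVec_apply_of_length_eq hd w hs _ (by simp) _
  have hx : ∀ t u, wordProd (pertMat d w F s t) u *ᵥ vacuum w =
      y u + (t * f u) • Pi.single s 1 := fun t u => by
    simp only [hy, wordProd_eq_prod_map]
    rw [pertMat_prod_mulVec_vacuum_of_eq hd hw hsurj F hs t _ (by simp), hF]
  have key : ∀ t : ℝ, 0 ≤ ∑ u, ∑ v, A u v * (y u ⬝ᵥ y v) + t ^ 2 * (f ⬝ᵥ (A *ᵥ f)) := by
    intro t
    have h := (hA (pertMat d w F s t) (pertMat_isSymm w F s t)).dotProduct_mulVec_nonneg (vacuum w)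
    have h2 : star (vacuum w) ⬝ᵥ (∑ u, ∑ v, A u v • ((wordProd (pertMat d w F s t) u)ᴴ *
        wordProd (pertMat d w F s t) v)) *ᵥ vacuum w =
        ∑ u, ∑ v, A u v * (y u ⬝ᵥ y v + t ^ 2 * (f u * f v)) := by
      simp only [Matrix.sum_mulVec, dotProduct_sum, Matrix.smul_mulVec, dotProduct_smul,
        smul_eq_mul]
      refine Finset.sum_congr rfl fun u _ => Finset.sum_congr rfl fun v _ => ?_
      rw [← Matrix.mulVec_mulVec, Matrix.dotProduct_mulVec, ← Matrix.star_mulVec, hx, hx,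
        star_trivial]
      simp [add_dotProduct, dotProduct_add, hys]
      ring_nf
      tauto
    rw [h2] at h
    refine h.trans_eq ?_
    simp only [dotProduct, Matrix.mulVec, Finset.mul_sum, mul_add, Finset.sum_add_distrib]
    congr 1
    refine Finset.sum_congr rfl fun u _ => Finset.sum_congr rfl fun v _ => ?_
    ring
  by_contra! hneg
  set c := ∑ u, ∑ v, A u v * (y u ⬝ᵥ y v)
  set q := f ⬝ᵥ (A *ᵥ f)
  have h := key (√((|c| + 1) / -q))
  rw [Real.sq_sqrt (div_nonneg (by positivity) (by linarith)), div_mul_eq_mul_div, div_neg,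
    mul_div_cancel_right₀ _ hneg.ne] at h
  linarith [le_abs_self c]

lemma exists_labelling (n d : ℕ) (hn : 2 ≤ n) :
    ∃ w : Fin ((n ^ (d + 1) - 1) / (n - 1)) → List (Fin n), w.Injective ∧
      ∀ l : List (Fin n), l.length ≤ d → ∃ b, w b = l := by
  have hcard : Fintype.card (Σ k : Fin (d + 1), List.Vector (Fin n) k) =
      (n ^ (d + 1) - 1) / (n - 1) := by
    rw [← Nat.geomSum_eq hn]
    simp [Finset.sum_range]
  refine ⟨fun b => ((Fintype.equivFinOfCardEq hcard).symm b).2.1, ?_, ?_⟩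
  · refine Function.Injective.comp (g := fun x : Σ k : Fin (d + 1), List.Vector (Fin n) k =>
      x.2.1) ?_ (Equiv.injective _)
    rintro ⟨⟨k, hk⟩, l, hl⟩ ⟨⟨k', hk'⟩, l', hl'⟩ h
    dsimp at h hl hl'
    subst h hl hl'
    rfl
  · intro l hl
    exact ⟨Fintype.equivFinOfCardEq hcard ⟨⟨l.length, by omega⟩, l, rfl⟩, by
      dsimp only; rw [Equiv.symm_apply_apply]⟩

lemma posSemidef_of_map_ofReal {κ : Type*} [Fintype κ] {A : Matrix κ κ ℝ}
    (h : (A.map Complex.ofReal).PosSemidef) : A.PosSemidef := by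
  rw [Matrix.posSemidef_iff_dotProduct_mulVec] at h ⊢
  refine ⟨?_, fun x => ?_⟩
  · ext i j
    have := congrFun (congrFun h.1 i) j
    simpa using this
  · have := h.2 (fun i => (x i : ℂ))
    have h2 : star (fun i => (x i : ℂ)) ⬝ᵥ (A.map Complex.ofReal *ᵥ fun i => (x i : ℂ)) =
        ((star x ⬝ᵥ (A *ᵥ x) : ℝ) : ℂ) := by
      simp [dotProduct, Matrix.mulVec]
    rw [h2] at this
    exact_mod_cast this

lemma map_nchs {R S : Type*} [Ring R] [Ring S] [Algebra ℝ R] [Algebra ℝ S] (φ : R →ₐ[ℝ] S)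
    {n : ℕ} (d : ℕ) (X : Fin n → R) : φ (nchs d X) = nchs d fun j => φ (X j) := by
  simp only [nchs, map_sum, map_smul]
  refine Finset.sum_congr rfl fun w _ => ?_
  congr 1
  exact map_wordProd (φ : R →* S) X w

/-- The three characterizations of the operator lower bound `μ` for `H_{2d}`:
(i) all hermitian operator tuples, (ii) symmetric `K×K` matrices with
`K = (n^{d+1}-1)/(n-1)`, (iii) positive semidefiniteness of `G_{n,d} - μ M_{n,d}`. -/
theorem stmt_11 (n d : ℕ) (hn : 2 ≤ n) (hd : 1 ≤ d) (μ : ℝ) :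
    ((∀ (k : ℕ) (X : Fin n → Matrix (Fin k) (Fin k) ℂ), (∀ j, (X j).IsHermitian) →
        (nchs (2 * d) X - μ • ∑ j : Fin n, X j ^ (2 * d)).PosSemidef) ↔
      (Gmat n d - μ • Mmat n d).PosSemidef) ∧
    ((∀ X : Fin n → Matrix (Fin ((n ^ (d + 1) - 1) / (n - 1)))
          (Fin ((n ^ (d + 1) - 1) / (n - 1))) ℝ, (∀ j, (X j).IsSymm) →
        (nchs (2 * d) X - μ • ∑ j : Fin n, X j ^ (2 * d)).PosSemidef) ↔
      (Gmat n d - μ • Mmat n d).PosSemidef) := by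
  have hreal : (∀ X : Fin n → Matrix (Fin ((n ^ (d + 1) - 1) / (n - 1)))
          (Fin ((n ^ (d + 1) - 1) / (n - 1))) ℝ, (∀ j, (X j).IsSymm) →
        (nchs (2 * d) X - μ • ∑ j : Fin n, X j ^ (2 * d)).PosSemidef) →
      (Gmat n d - μ • Mmat n d).PosSemidef := by
    intro h
    obtain ⟨w, hw, hsurj⟩ := exists_labelling n d hn
    rw [Matrix.posSemidef_iff_dotProduct_mulVec]
    refine ⟨?_, nonneg_of_forall_posSemidef (by omega) hd hw hsurj _ fun X hX => ?_⟩
    · ext u v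
      simp only [Matrix.conjTranspose_apply, Matrix.sub_apply, Matrix.smul_apply, Gmat, Mmat,
        star_trivial, add_comm (letterCount v _)]
      congr 3
      apply propext
      constructor <;> rintro ⟨rfl, h⟩ <;> exact ⟨rfl, h⟩
    · have := h X hX
      rwa [nchs_sub_eq_sum hd μ X fun j => by
        rw [Matrix.star_eq_conjTranspose, Matrix.conjTranspose_eq_transpose_of_trivial, hX j]]
        at this
  refine ⟨⟨fun h => hreal fun X hX => ?_, fun h k X hX => ?_⟩, hreal, fun h X hX => ?_⟩
  · have h1 := h _ (fun j => (X j).map Complex.ofReal) fun j => by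
      ext a b
      simp [Matrix.conjTranspose_apply, (hX j).apply]
    have h2 : nchs (2 * d) (fun j => (X j).map Complex.ofReal) -
        μ • ∑ j : Fin n, (X j).map Complex.ofReal ^ (2 * d) =
        (nchs (2 * d) X - μ • ∑ j : Fin n, X j ^ (2 * d)).map Complex.ofReal := by
      have := map_nchs (Complex.ofRealAm.mapMatrix (m := Fin ((n ^ (d + 1) - 1) / (n - 1))))
        (2 * d) X
      change nchs (2 * d) (fun j => Complex.ofRealAm.mapMatrix (X j)) -
        μ • ∑ j : Fin n, Complex.ofRealAm.mapMatrix (X j) ^ (2 * d) =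
        Complex.ofRealAm.mapMatrix (nchs (2 * d) X - μ • ∑ j : Fin n, X j ^ (2 * d))
      rw [map_sub, map_smul, map_sum, this]
      simp only [map_pow]
    rw [h2] at h1
    exact posSemidef_of_map_ofReal h1
  · rw [nchs_sub_eq_sum hd μ X hX]
    exact posSemidef_sum_smul_conjTranspose_mul h _
  · rw [nchs_sub_eq_sum hd μ X fun j => by
      rw [Matrix.star_eq_conjTranspose, Matrix.conjTranspose_eq_transpose_of_trivial, hX j]]
    exact posSemidef_sum_smul_conjTranspose_mul h _
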